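/- Let n ≥ 1 and A ∈ GL_n(ℂ), and suppose the minimal polynomial of A over ℂ factors as ∏_{i=1}^m (X − λ_i)^{n_i} with λ_1, …, λ_m pairwise distinct (and nonzero, since A is invertible) and n_1 + ⋯ + n_m = p. Index by pairs (i, l) with 1 ≤ i ≤ m and 0 ≤ l ≤ n_i − 1 the p functions F_{(i,l)} : ℤ → ℂ defined by F_{(i,l)}(k) := g_l(k)·λ_i^{k−l} (integer powers of the nonzero λ_i). Let V be the p×p matrix with rows indexed by the pairs (i,l), columns indexed by j ∈ {1, …, p}, and entries V_{(i,l),j} := F_{(i,l)}(−j). Then V is invertible, and for every integer k ∈ ℤ one has A^k = Σ_{(i,l)} (V⁻¹ · F(k))_{(i,l)} · A^{−σ(i,l)}, where F(k) denotes the vector with entries F_{(i,l)}(k), σ is the bijection from the pairs (i,l) (ordered lexicographically) to {1, …, p}, and the coefficient vector V⁻¹·F(k) is the matrix–vector product. -/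

import Mathlib

/-- `g l z = z(z-1)⋯(z-l+1)/l!`, with `g 0 z = 1`. -/
noncomputable def g (l : ℕ) (z : ℂ) : ℂ :=
  (∏ i ∈ Finset.range l, (z - i)) / (l.factorial : ℂ)

theorem g_succ_add_one (l : ℕ) (z : ℂ) : g (l + 1) (z + 1) = g (l + 1) z + g l z := by
  have h1 : ∏ i ∈ Finset.range (l + 1), (z + 1 - (i : ℂ)) =
      (z + 1) * ∏ i ∈ Finset.range l, (z - i) := by
    rw [Finset.prod_range_succ', mul_comm]
    congr 1
    · simp
    · exact Finset.prod_congr rfl fun i _ => by push_cast; ring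
  have hl : (l.factorial : ℂ) ≠ 0 := by exact_mod_cast l.factorial_ne_zero
  have hl' : (l : ℂ) + 1 ≠ 0 := by exact_mod_cast l.succ_ne_zero
  unfold g
  rw [h1, Finset.prod_range_succ, Nat.factorial_succ]
  push_cast
  field_simp
  ring

/-- The sequence `k ↦ g_l(k) c^(k-l)`, i.e. the `l`-th divided derivative of `X^k` at `c`. -/
noncomputable def zpowHasseDeriv (c : ℂ) (l : ℕ) (k : ℤ) : ℂ := g l k * c ^ (k - (l : ℤ))

theorem zpowHasseDeriv_zero_add_one {c : ℂ} (hc : c ≠ 0) (k : ℤ) :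
    zpowHasseDeriv c 0 (k + 1) = c * zpowHasseDeriv c 0 k := by
  simp [zpowHasseDeriv, g, zpow_add_one₀ hc, mul_comm]

theorem zpowHasseDeriv_succ_add_one {c : ℂ} (hc : c ≠ 0) (l : ℕ) (k : ℤ) :
    zpowHasseDeriv c (l + 1) (k + 1) =
      c * zpowHasseDeriv c (l + 1) k + zpowHasseDeriv c l k := by
  have h1 : k + 1 - ((l + 1 : ℕ) : ℤ) = k - l := by push_cast; ring
  have h2 : c ^ (k - (l : ℤ)) = c ^ (k - ((l + 1 : ℕ) : ℤ)) * c := by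
    rw [← zpow_add_one₀ hc]; congr 1; push_cast; ring
  simp only [zpowHasseDeriv]
  push_cast [g_succ_add_one] at *
  rw [h1, h2]
  ring

open Polynomial in
theorem coeff_taylor_X_pow {c : ℂ} (hc : c ≠ 0) (l k : ℕ) :
    (taylor c (X ^ k)).coeff l = zpowHasseDeriv c l k := by
  induction k generalizing l with
  | zero =>
    cases l with
    | zero => simp [zpowHasseDeriv, g]
    | succ l => simp [zpowHasseDeriv, g, Finset.prod_range_succ', coeff_one]
  | succ k ih =>
    rw [pow_succ', taylor_mul, taylor_X, add_mul, coeff_add, coeff_C_mul, ih]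
    cases l with
    | zero => simp [zpowHasseDeriv_zero_add_one hc]
    | succ l =>
      rw [coeff_X_mul, ih]
      push_cast
      rw [zpowHasseDeriv_succ_add_one hc]
      ring

theorem sum_zpowHasseDeriv_add_eq_zero {ι : Type*} (s : Finset ι) (a : ι → ℂ) (e : ι → ℤ)
    {c : ℂ} (hc : c ≠ 0) {r : ℕ}
    (h : ∀ l < r, ∑ j ∈ s, a j * zpowHasseDeriv c l (e j) = 0) (N : ℕ) :
    ∀ l < r, ∑ j ∈ s, a j * zpowHasseDeriv c l (e j + N) = 0 := by
  induction N with
  | zero => simpa using h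
  | succ N ih =>
    intro l hl
    cases l with
    | zero =>
      rw [← mul_zero c, ← ih 0 hl, Finset.mul_sum]
      refine Finset.sum_congr rfl fun j _ => ?_
      push_cast
      rw [← add_assoc, zpowHasseDeriv_zero_add_one hc]
      ring
    | succ l =>
      have h0 : c * ∑ j ∈ s, a j * zpowHasseDeriv c (l + 1) (e j + N) +
          ∑ j ∈ s, a j * zpowHasseDeriv c l (e j + N) = 0 := by
        rw [ih (l + 1) hl, ih l (by omega)]; simp
      rw [← h0, Finset.mul_sum, ← Finset.sum_add_distrib]
      refine Finset.sum_congr rfl fun j _ => ?_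
      push_cast
      rw [← add_assoc, zpowHasseDeriv_succ_add_one hc]
      ring

open Polynomial in
theorem X_sub_C_pow_dvd_of_coeff_taylor {c : ℂ} {r : ℕ} {P : ℂ[X]}
    (h : ∀ l < r, (taylor c P).coeff l = 0) : (X - C c) ^ r ∣ P := by
  obtain ⟨Q, hQ⟩ := X_pow_dvd_iff.2 h
  refine ⟨taylor (-c) Q, ?_⟩
  apply taylor_injective c
  rw [hQ, taylor_mul, taylor_pow, taylor_taylor]
  simp

open Polynomial in
/-- If a Laurent polynomial `∑ a_j X^(e_j)` vanishes to order `r i` at each of the distinct nonzero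
points `c i`, then multiplying by `X^N` to clear denominators gives a multiple of
`∏ (X - c i)^(r i)`. -/
theorem prod_X_sub_C_pow_dvd_sum {κ ι : Type*} [Fintype κ] {c : κ → ℂ}
    (hinj : Function.Injective c) (hc : ∀ i, c i ≠ 0) (r : κ → ℕ)
    (s : Finset ι) (a : ι → ℂ) (e : ι → ℤ) (N : ℕ) (d : ι → ℕ)
    (hd : ∀ j ∈ s, (d j : ℤ) = e j + N)
    (h : ∀ i, ∀ l < r i, ∑ j ∈ s, a j * zpowHasseDeriv (c i) l (e j) = 0) :
    ∏ i, (X - C (c i)) ^ r i ∣ ∑ j ∈ s, C (a j) * X ^ d j := by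
  refine Fintype.prod_dvd_of_coprime (fun i j hij => ?_) fun i => ?_
  · exact (isCoprime_X_sub_C_of_isUnit_sub
      (sub_ne_zero.2 (hinj.ne hij)).isUnit).pow
  · refine X_sub_C_pow_dvd_of_coeff_taylor fun l hl => ?_
    rw [← sum_zpowHasseDeriv_add_eq_zero s a e (hc i) (h i) N l hl, map_sum, finsetSum_coeff]
    refine Finset.sum_congr rfl fun j hj => ?_
    rw [taylor_mul, taylor_C, coeff_C_mul, coeff_taylor_X_pow (hc i), hd j hj]

theorem sum_filter_lt_add_le {m : ℕ} (r : Fin m → ℕ) {i j : Fin m} (hij : i < j) :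
    ∑ k ∈ Finset.univ.filter (fun k : Fin m => k < i), r k + r i ≤
      ∑ k ∈ Finset.univ.filter (fun k : Fin m => k < j), r k := by
  rw [add_comm, ← Finset.sum_insert (by simp)]
  refine Finset.sum_le_sum_of_subset fun k hk => ?_
  simp only [Finset.mem_insert, Finset.mem_filter, Finset.mem_univ, true_and] at hk ⊢
  rcases hk with rfl | hk
  · exact hij
  · exact hk.trans hij

theorem sum_filter_lt_add_le_sum {m : ℕ} (r : Fin m → ℕ) (i : Fin m) :
    ∑ k ∈ Finset.univ.filter (fun k : Fin m => k < i), r k + r i ≤ ∑ k, r k := by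
  rw [add_comm, ← Finset.sum_insert (by simp)]
  exact Finset.sum_le_sum_of_subset (Finset.subset_univ _)

theorem lexPosition_injective {m : ℕ} (r : Fin m → ℕ) :
    Function.Injective fun x : (i : Fin m) × Fin (r i) =>
      ∑ k ∈ Finset.univ.filter (fun k : Fin m => k < x.1), r k + (x.2 : ℕ) + 1 := by
  rintro ⟨i, l⟩ ⟨j, l'⟩ h
  dsimp only at h
  rcases lt_trichotomy i j with hij | rfl | hij
  · have := sum_filter_lt_add_le r hij
    omega
  · have : l = l' := Fin.ext (by omega)
    rw [this]
  · have := sum_filter_lt_add_le r hij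
    omega


/-- let the minimal polynomial of the invertible matrix `A` factor as
`∏ (X − λ_i)^{n_i}` with the `λ_i` pairwise distinct and nonzero, `Σ n_i = p`. With the
functions `F_{(i,l)}(k) = g_l(k)·λ_i^{k−l}` on `ℤ`, the lexicographic (1-based) position
function `σ(i,l) = Σ_{i'<i} n_{i'} + l + 1`, and the `p×p` matrix `V` with rows and (via
`σ`) columns indexed by the pairs `(i,l)`, entries `V_{x,y} = F_x(−σ(y))`, the matrix `V`
is invertible and for every `k ∈ ℤ`,
`A^k = Σ_{(i,l)} (V⁻¹·F(k))_{(i,l)} · A^{−σ(i,l)}`. -/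
theorem zpow_eq_sum_generalized_vandermonde_inv (n : ℕ) (hn : 1 ≤ n)
    (A : Matrix (Fin n) (Fin n) ℂ) (hA : IsUnit A)
    (m : ℕ) (lam : Fin m → ℂ) (hinj : Function.Injective lam) (hne : ∀ i, lam i ≠ 0)
    (nsize : Fin m → ℕ) (hns : ∀ i, 1 ≤ nsize i) (p : ℕ) (hsum : ∑ i, nsize i = p)
    (hmin : minpoly ℂ A = ∏ i : Fin m, (Polynomial.X - Polynomial.C (lam i)) ^ nsize i)
    (F : ((i : Fin m) × Fin (nsize i)) → ℤ → ℂ)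
    (hF : ∀ x k, F x k = g ((x.2 : ℕ)) ((k : ℂ)) * lam x.1 ^ (k - ((x.2 : ℕ) : ℤ)))
    (σ : ((i : Fin m) × Fin (nsize i)) → ℕ)
    (hσ : ∀ x, σ x = (∑ i ∈ Finset.univ.filter (fun i : Fin m => i < x.1), nsize i)
      + (x.2 : ℕ) + 1)
    (V : Matrix ((i : Fin m) × Fin (nsize i)) ((i : Fin m) × Fin (nsize i)) ℂ)
    (hV : ∀ x y, V x y = F x (-(σ y : ℤ))) :
    IsUnit V ∧
      ∀ k : ℤ, A ^ k =
        ∑ x : (i : Fin m) × Fin (nsize i),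
          V⁻¹.mulVec (fun y => F y k) x • A ^ (-(σ x : ℤ)) := by
  have hF' : ∀ x k, F x k = zpowHasseDeriv (lam x.1) x.2 k := hF
  have hσinj : Function.Injective σ := by
    have := lexPosition_injective nsize
    rwa [← funext hσ] at this
  have hσle : ∀ x, σ x ≤ p := fun x => by
    have := sum_filter_lt_add_le_sum nsize x.1
    rw [hσ, ← hsum]
    omega
  have hσpos : ∀ x, 1 ≤ σ x := fun x => by rw [hσ]; omega
  have hVunit : IsUnit V := by
    rw [← Matrix.mulVec_injective_iff_isUnit, ← Matrix.coe_mulVecLin,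
      injective_iff_map_eq_zero]
    intro w hw
    have hdvd := prod_X_sub_C_pow_dvd_sum hinj hne nsize Finset.univ w
      (fun y => -(σ y : ℤ)) p (fun y => p - σ y)
      (fun y _ => by have := hσle y; push_cast [this]; ring)
      (fun i l hl => by
        have := congrFun hw ⟨i, ⟨l, hl⟩⟩
        simp only [Matrix.mulVecLin_apply, Matrix.mulVec, dotProduct, hV, hF'] at this
        simpa [mul_comm] using this)
    have hmonic : (∏ i, (Polynomial.X - Polynomial.C (lam i)) ^ nsize i).Monic :=
      Polynomial.monic_prod_of_monic _ _ fun i _ => (Polynomial.monic_X_sub_C _).pow _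
    have hdeg : (∏ i, (Polynomial.X - Polynomial.C (lam i)) ^ nsize i).natDegree = p := by
      rw [Polynomial.natDegree_prod_of_monic _ _
        fun i _ => (Polynomial.monic_X_sub_C _).pow _]
      simpa [Polynomial.natDegree_pow] using hsum
    have hzero := Polynomial.eq_zero_of_dvd_of_degree_lt hdvd (by
      rw [Polynomial.degree_eq_natDegree hmonic.ne_zero, hdeg]
      refine Polynomial.mem_degreeLT.1 (Submodule.sum_mem _ fun y _ => ?_)
      refine Polynomial.mem_degreeLT.2 ((Polynomial.degree_C_mul_X_pow_le _ _).trans_lt ?_)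
      have h1 := hσle y
      have h2 := hσpos y
      exact_mod_cast (by omega : p - σ y < p))
    ext x
    have hx := congrArg (fun P => Polynomial.coeff P (p - σ x)) hzero
    simp only [Polynomial.finsetSum_coeff, Polynomial.coeff_C_mul_X_pow,
      Polynomial.coeff_zero] at hx
    rw [Finset.sum_eq_single x] at hx
    · simpa using hx
    · intro y _ hy
      refine if_neg fun h => hy (hσinj ?_)
      have h1 := hσle y
      have h2 := hσle x
      omega
    · simp
  refine ⟨hVunit, fun k => ?_⟩
  have hdet : IsUnit A.det := (Matrix.isUnit_iff_isUnit_det A).1 hA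
  set w := V⁻¹.mulVec (fun y => F y k) with hw
  have hVw : V.mulVec w = fun y => F y k := by
    rw [hw, Matrix.mulVec_mulVec,
      Matrix.mul_nonsing_inv _ ((Matrix.isUnit_iff_isUnit_det V).1 hVunit), Matrix.one_mulVec]
  have hN : ∀ y, σ y ≤ p + k.natAbs := fun y => (hσle y).trans (Nat.le_add_right _ _)
  have hkN : (((k + (p + k.natAbs : ℕ)).toNat : ℕ) : ℤ) = k + (p + k.natAbs : ℕ) := by omega
  have hdvd := prod_X_sub_C_pow_dvd_sum hinj hne nsize
    (Finset.univ : Finset (Option ((i : Fin m) × Fin (nsize i))))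
    (fun o => o.elim (-1) w) (fun o => o.elim k fun y => -(σ y : ℤ)) (p + k.natAbs)
    (fun o => o.elim (k + (p + k.natAbs : ℕ)).toNat fun y => p + k.natAbs - σ y)
    (by
      rintro (_ | y) _
      · exact hkN
      · have := hN y
        simp only [Option.elim]
        omega)
    (fun i l hl => by
      have := congrFun hVw ⟨i, ⟨l, hl⟩⟩
      simp only [Matrix.mulVec, dotProduct, hV, hF'] at this
      simp only [Fintype.sum_option, Option.elim, ← this]
      rw [neg_one_mul, neg_add_eq_zero]
      exact Finset.sum_congr rfl fun y _ => mul_comm _ _)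
  rw [← hmin, minpoly.dvd_iff] at hdvd
  simp only [Fintype.sum_option, Option.elim, map_add, map_sum, map_mul, map_pow,
    Polynomial.aeval_C, Polynomial.aeval_X, map_neg, map_one, neg_one_mul, neg_add_eq_zero,
    ← Algebra.smul_def] at hdvd
  have hpow : ∀ (d : ℕ) (e : ℤ), (d : ℤ) = e + (p + k.natAbs : ℕ) →
      A ^ d = A ^ e * A ^ (p + k.natAbs) := fun d e h => by
    rw [← zpow_natCast A d, h, Matrix.zpow_add hdet, zpow_natCast]
  rw [hpow _ k hkN] at hdvd
  refine (hA.pow (p + k.natAbs)).mul_left_injective ?_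
  dsimp only
  rw [hdvd, Finset.sum_mul]
  refine Finset.sum_congr rfl fun y _ => ?_
  rw [hpow _ (-(σ y : ℤ)) (by have := hN y; omega), smul_mul_assoc]
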